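/- Let T > 0, 2 ≤ p < 3, f ∈ C²_b(ℝ; L(ℝ^N,ℝ)), and let ω be a regular control on [0,T]. Then there exists a constant C > 0, depending only on f, p and ω, such that: for every a ≥ 0 and every x ∈ C¹([0,T];ℝ^N) satisfying |δx_{st}| + |X²_{st}|^{1/2} ≤ ω(s,t)^{1/p} for all s ≤ t (where X^{2,ij}_{st} := ∫_s^t (x^i_u − x^i_s)(x^j)'(u) du), every solution (y,m) of the reflected ODE driven by x with initial condition a satisfies m_T ≤ C. In particular, the total variation of the reflection measures of the approximating reflected ODEs is bounded uniformly in the approximation parameter. -/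

import Mathlib

open MeasureTheory Set Filter

noncomputable section

/-- The set of partition sums `Σ ‖g(t_i, t_{i+1})‖^p` over partitions of `[s,t]`. -/
def partitionSums {E : Type*} [NormedAddCommGroup E] (p s t : ℝ) (g : ℝ → ℝ → E) : Set ℝ :=
  {x | ∃ (n : ℕ) (u : ℕ → ℝ), u 0 = s ∧ u n = t ∧ (∀ i < n, u i < u (i + 1)) ∧
    x = ∑ i ∈ Finset.range n, ‖g (u i) (u (i + 1))‖ ^ p}

/-- `‖g‖^p_{V̄^p_2([s,t];E)}`, the `p`-th power of the `p`-variation norm. -/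
def pVarSum {E : Type*} [NormedAddCommGroup E] (p s t : ℝ) (g : ℝ → ℝ → E) : ℝ :=
  sSup (partitionSums p s t g)

/-- The `p`-variation norm `‖g‖_{V̄^p_2([s,t];E)}`. -/
def pVarNorm {E : Type*} [NormedAddCommGroup E] (p s t : ℝ) (g : ℝ → ℝ → E) : ℝ :=
  (pVarSum p s t g) ^ (1 / p)

/-- A control on the interval `[a,b]`: nonnegative and superadditive. -/
def IsControl (a b : ℝ) (ω : ℝ → ℝ → ℝ) : Prop :=
  (∀ s t, a ≤ s → s ≤ t → t ≤ b → 0 ≤ ω s t) ∧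
  (∀ s u t, a ≤ s → s ≤ u → u ≤ t → t ≤ b → ω s u + ω u t ≤ ω s t)

/-- A regular control: moreover `ω(s,t) → 0` as `|t - s| → 0`. -/
def IsRegularControl (a b : ℝ) (ω : ℝ → ℝ → ℝ) : Prop :=
  IsControl a b ω ∧
  ∀ ε > 0, ∃ δ > 0, ∀ s t, a ≤ s → s ≤ t → t ≤ b → t - s < δ → ω s t < ε

/-- `g ∈ V^p_2([a,b];E)` : finite `p`-variation whose associated control is regular. -/
def MemVp2 {E : Type*} [NormedAddCommGroup E] (p a b : ℝ) (g : ℝ → ℝ → E) : Prop :=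
  (∀ s t, a ≤ s → s ≤ t → t ≤ b → BddAbove (partitionSums p s t g)) ∧
  IsRegularControl a b (fun s t => pVarSum p s t g)

/-- `y ∈ V^p_1([a,b];E)` for a path `y`. -/
def MemVp1 {E : Type*} [NormedAddCommGroup E] (p a b : ℝ) (y : ℝ → E) : Prop :=
  MemVp2 p a b (fun s t => y t - y s)

/-- `f ∈ C^k_b(ℝ;ℝ)` : `k` times differentiable, bounded with bounded derivatives. -/
def CbOfDeg (k : ℕ) (f : ℝ → ℝ) : Prop :=
  ContDiff ℝ k f ∧ ∀ j ≤ k, ∃ C, ∀ x, |iteratedDeriv j f x| ≤ C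

/-- The step-2 lift of a `C¹` path `x`:
`X²_{st}^{ij} = ∫_s^t (x^i_u - x^i_s) (x^j)'(u) du`. -/
def smoothLift {N : ℕ} (x : ℝ → Fin N → ℝ) : ℝ → ℝ → Fin N → Fin N → ℝ :=
  fun s t i j => ∫ u in s..t, (x u i - x s i) * deriv (fun v => x v j) u

/-- `(y, m)` (with Stieltjes measure `μ` of `m`) solves the reflected ODE
`dy = f(y) dx + dm`, `y dm = 0` on `[0,T]`, driven by the `C¹` path `x`, with initial
condition `a`. -/
def SolvesReflectedODE (T : ℝ) {N : ℕ} (f : Fin N → ℝ → ℝ) (x : ℝ → Fin N → ℝ)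
    (a : ℝ) (y m : ℝ → ℝ) (μ : MeasureTheory.Measure ℝ) : Prop :=
  ContinuousOn y (Set.Icc 0 T) ∧ (∀ t ∈ Set.Icc (0 : ℝ) T, 0 ≤ y t) ∧
  ContinuousOn m (Set.Icc 0 T) ∧ MonotoneOn m (Set.Icc (0 : ℝ) T) ∧
  m 0 = 0 ∧ (∀ t ∈ Set.Icc (0 : ℝ) T, 0 ≤ m t) ∧
  y 0 = a ∧
  (∀ s t, 0 ≤ s → s ≤ t → t ≤ T →
    y t - y s = (∑ i, ∫ u in s..t, f i (y u) * deriv (fun v => x v i) u) + (m t - m s)) ∧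
  (∀ s t, 0 ≤ s → s ≤ t → t ≤ T → μ (Set.Ioc s t) = ENNReal.ofReal (m t - m s)) ∧
  μ {u | u ∈ Set.Ioc (0 : ℝ) T ∧ y u ≠ 0} = 0

/-- The second-order remainder of the reflected equation: what is left of `δy` after removing the
Davie expansion of `∫ f(y) dx` and the reflection increment. -/
def roughRemainder {N : ℕ} (f : Fin N → ℝ → ℝ) (x : ℝ → Fin N → ℝ) (y m : ℝ → ℝ) (s t : ℝ) : ℝ :=
  y t - y s - (m t - m s) - (∑ j, f j (y s) * (x t j - x s j))
    - ∑ i, ∑ j, f i (y s) * deriv (f j) (y s) * smoothLift x s t i j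

lemma abs_sum_fin_le {N : ℕ} {g : Fin N → ℝ} {c : ℝ} (h : ∀ i, |g i| ≤ c) :
    |∑ i, g i| ≤ N * c := by
  calc |∑ i, g i| ≤ ∑ i, |g i| := Finset.abs_sum_le_sum_abs _ _
    _ ≤ ∑ _i : Fin N, c := Finset.sum_le_sum fun i _ => h i
    _ = N * c := by simp

lemma abs_sum_sum_fin_le {N : ℕ} {g : Fin N → Fin N → ℝ} {c : ℝ} (h : ∀ i j, |g i j| ≤ c) :
    |∑ i, ∑ j, g i j| ≤ N * (N * c) :=
  abs_sum_fin_le fun i => abs_sum_fin_le (h i)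

lemma abs_sub_le_of_abs_deriv_le {φ : ℝ → ℝ} {A : ℝ} (hφ : Differentiable ℝ φ)
    (h : ∀ z, |deriv φ z| ≤ A) (z w : ℝ) : |φ w - φ z| ≤ A * |w - z| := by
  simpa using Convex.norm_image_sub_le_of_norm_deriv_le (s := univ) (f := φ) (x := z) (y := w)
    (fun v _ => hφ v) (fun v _ => h v) convex_univ (mem_univ _) (mem_univ _)

lemma abs_taylor_one_le {φ : ℝ → ℝ} {A : ℝ} (hφ : Differentiable ℝ φ)
    (hφ' : Differentiable ℝ (deriv φ)) (h : ∀ z, |deriv (deriv φ) z| ≤ A) (z α : ℝ) :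
    |φ (z + α) - φ z - deriv φ z * α| ≤ A * α ^ 2 := by
  have hA : 0 ≤ A := (abs_nonneg _).trans (h 0)
  have key := Convex.norm_image_sub_le_of_norm_hasDerivWithin_le (s := uIcc z (z + α))
    (f := fun w => φ w - deriv φ z * w) (f' := fun w => deriv φ w - deriv φ z * 1)
    (C := A * |α|) (x := z) (y := z + α)
    (fun w _ => ((hφ w).hasDerivAt.sub ((hasDerivAt_id w).const_mul _)).hasDerivWithinAt)
    (fun w hw => ?_) (convex_uIcc _ _) left_mem_uIcc right_mem_uIcc
  · simp only [Real.norm_eq_abs, add_sub_cancel_left] at key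
    calc _ = |φ (z + α) - deriv φ z * (z + α) - (φ z - deriv φ z * z)| := by ring_nf
      _ ≤ _ := key
      _ = A * α ^ 2 := by rw [mul_assoc, abs_mul_abs_self]; ring
  · rw [mul_one, Real.norm_eq_abs]
    refine (abs_sub_le_of_abs_deriv_le hφ' h z w).trans (mul_le_mul_of_nonneg_left ?_ hA)
    exact (abs_sub_left_of_mem_uIcc hw).trans_eq (by rw [add_sub_cancel_left])

/-- A common bound for the coefficients and their first two derivatives. -/
lemma exists_common_bound {N : ℕ} {f : Fin N → ℝ → ℝ} (hf : ∀ i, CbOfDeg 2 (f i)) :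
    ∃ A : ℝ, 0 ≤ A ∧ ∀ i z, |f i z| ≤ A ∧ |deriv (f i) z| ≤ A ∧ |deriv (deriv (f i)) z| ≤ A := by
  choose c0 h0 using fun i => (hf i).2 0 (by norm_num)
  choose c1 h1 using fun i => (hf i).2 1 (by norm_num)
  choose c2 h2 using fun i => (hf i).2 2 le_rfl
  simp only [iteratedDeriv_zero, iteratedDeriv_succ] at h0 h1 h2
  have hle (c : Fin N → ℝ) (i : Fin N) : c i ≤ ∑ k, |c k| :=
    (le_abs_self _).trans (Finset.single_le_sum (f := fun k => |c k|) (fun _ _ => abs_nonneg _)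
      (Finset.mem_univ i))
  have hnn (c : Fin N → ℝ) : 0 ≤ ∑ k, |c k| := Finset.sum_nonneg fun _ _ => abs_nonneg _
  refine ⟨∑ k, |c0 k| + ∑ k, |c1 k| + ∑ k, |c2 k|, ?_, fun i z => ⟨?_, ?_, ?_⟩⟩
  · linarith [hnn c0, hnn c1, hnn c2]
  · linarith [hnn c1, hnn c2, h0 i z, hle c0 i]
  · linarith [hnn c0, hnn c2, h1 i z, hle c1 i]
  · linarith [hnn c0, hnn c1, h2 i z, hle c2 i]

lemma contDiff_coord {N : ℕ} {x : ℝ → Fin N → ℝ} (hx : ContDiff ℝ 1 x) (i : Fin N) :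
    ContDiff ℝ 1 (fun v => x v i) := contDiff_pi.1 hx i

lemma continuous_deriv_coord {N : ℕ} {x : ℝ → Fin N → ℝ} (hx : ContDiff ℝ 1 x) (i : Fin N) :
    Continuous (deriv fun v => x v i) := (contDiff_coord hx i).continuous_deriv le_rfl

lemma intervalIntegrable_const_mul_deriv_coord {N : ℕ} {x : ℝ → Fin N → ℝ} (hx : ContDiff ℝ 1 x)
    (i : Fin N) (c s t : ℝ) :
    IntervalIntegrable (fun u => c * deriv (fun v => x v i) u) volume s t :=
  (continuous_const.mul (continuous_deriv_coord hx i)).intervalIntegrable _ _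

lemma integral_deriv_coord {N : ℕ} {x : ℝ → Fin N → ℝ} (hx : ContDiff ℝ 1 x) (i : Fin N)
    (s t : ℝ) : ∫ u in s..t, deriv (fun v => x v i) u = x t i - x s i :=
  intervalIntegral.integral_deriv_eq_sub
    (fun _ _ => ((contDiff_coord hx i).differentiable one_ne_zero).differentiableAt)
    ((continuous_deriv_coord hx i).intervalIntegrable _ _)

/-- Chen's relation for the canonical lift of a `C¹` path. -/
lemma smoothLift_chen {N : ℕ} {x : ℝ → Fin N → ℝ} (hx : ContDiff ℝ 1 x) (s u t : ℝ)
    (i j : Fin N) :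
    smoothLift x s t i j
      = smoothLift x s u i j + smoothLift x u t i j + (x u i - x s i) * (x t j - x u j) := by
  have hc (r : ℝ) : Continuous fun v => (x v i - x r i) * deriv (fun v => x v j) v :=
    (((contDiff_coord hx i).continuous).sub continuous_const).mul (continuous_deriv_coord hx j)
  have hsplit : smoothLift x s t i j
      = smoothLift x s u i j + ∫ v in u..t, (x v i - x s i) * deriv (fun v => x v j) v :=
    (intervalIntegral.integral_add_adjacent_intervals ((hc s).intervalIntegrable _ _)
      ((hc s).intervalIntegrable _ _)).symm
  have htail : ∫ v in u..t, (x v i - x s i) * deriv (fun v => x v j) v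
      = smoothLift x u t i j + (x u i - x s i) * (x t j - x u j) := by
    rw [← integral_deriv_coord hx j, ← intervalIntegral.integral_const_mul]
    unfold smoothLift
    rw [← intervalIntegral.integral_add ((hc u).intervalIntegrable _ _)
      (intervalIntegrable_const_mul_deriv_coord hx j _ _ _)]
    congr 1
    ext v
    ring
  rw [hsplit, htail, add_assoc]

lemma roughRemainder_defect_eq {N : ℕ} (f : Fin N → ℝ → ℝ) {x : ℝ → Fin N → ℝ}
    (hx : ContDiff ℝ 1 x) (y m : ℝ → ℝ) (s u t : ℝ) :
    roughRemainder f x y m s t - roughRemainder f x y m s u - roughRemainder f x y m u t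
      = (∑ j, (f j (y u) - f j (y s)
            - deriv (f j) (y s) * ∑ i, f i (y s) * (x u i - x s i)) * (x t j - x u j))
        + ∑ i, ∑ j, (f i (y u) * deriv (f j) (y u) - f i (y s) * deriv (f j) (y s))
            * smoothLift x u t i j := by
  have h1 : ∑ i, ∑ j, f i (y s) * deriv (f j) (y s) * smoothLift x s t i j
      = (∑ i, ∑ j, f i (y s) * deriv (f j) (y s) * smoothLift x s u i j)
        + (∑ i, ∑ j, f i (y s) * deriv (f j) (y s) * smoothLift x u t i j)
        + ∑ j, (deriv (f j) (y s) * ∑ i, f i (y s) * (x u i - x s i)) * (x t j - x u j) := by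
    have : ∑ j, (deriv (f j) (y s) * ∑ i, f i (y s) * (x u i - x s i)) * (x t j - x u j)
        = ∑ i, ∑ j, f i (y s) * deriv (f j) (y s) * ((x u i - x s i) * (x t j - x u j)) := by
      rw [Finset.sum_comm]
      refine Finset.sum_congr rfl fun j _ => ?_
      rw [Finset.mul_sum, Finset.sum_mul]
      exact Finset.sum_congr rfl fun i _ => by ring
    rw [this]
    simp only [← Finset.sum_add_distrib]
    refine Finset.sum_congr rfl fun i _ => Finset.sum_congr rfl fun j _ => ?_
    rw [smoothLift_chen hx s u t i j]
    ring
  have h2 : ∑ j, f j (y s) * (x t j - x s j)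
      = ∑ j, f j (y s) * (x u j - x s j) + ∑ j, f j (y s) * (x t j - x u j) := by
    rw [← Finset.sum_add_distrib]
    exact Finset.sum_congr rfl fun j _ => by ring
  unfold roughRemainder
  rw [h1, h2]
  simp only [sub_mul, Finset.sum_sub_distrib]
  ring

/-- Almost-additivity of the remainder. The bound is linear in the reflection and in the remainder
because the first-order Taylor expansion is only used along the driver. -/
lemma roughRemainder_defect_le {N : ℕ} {f : Fin N → ℝ → ℝ} {A : ℝ}
    (hf : ∀ i, CbOfDeg 2 (f i))
    (hA : ∀ i z, |f i z| ≤ A ∧ |deriv (f i) z| ≤ A ∧ |deriv (deriv (f i)) z| ≤ A) (hA0 : 0 ≤ A)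
    {x : ℝ → Fin N → ℝ} (hx : ContDiff ℝ 1 x) (y m : ℝ → ℝ) {s u t ρ : ℝ}
    (hρ0 : 0 ≤ ρ) (hρ1 : ρ ≤ 1) (hm : m s ≤ m u)
    (hsu : ∀ i, |x u i - x s i| ≤ ρ) (hut : ∀ i, |x t i - x u i| ≤ ρ)
    (hXsu : ∀ i j, |smoothLift x s u i j| ≤ ρ ^ 2) (hXut : ∀ i j, |smoothLift x u t i j| ≤ ρ ^ 2) :
    |roughRemainder f x y m s t - roughRemainder f x y m s u - roughRemainder f x y m u t|
      ≤ (4 * (N * A) ^ 3 + 2 * (N * A) ^ 4 + 2 * (N * A) ^ 2 + N * A)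
        * (ρ ^ 3 + ρ * (m u - m s + |roughRemainder f x y m s u|)) := by
  have hN : (0 : ℝ) ≤ N := Nat.cast_nonneg N
  set B : ℝ := N * A with hB
  have hB0 : 0 ≤ B := mul_nonneg hN hA0
  have hd (i) : Differentiable ℝ (f i) := (hf i).1.differentiable two_ne_zero
  have hd' (i) : Differentiable ℝ (deriv (f i)) := by
    have : ContDiff ℝ 1 (deriv (f i)) := by
      have h2 : ContDiff ℝ (1 + 1) (f i) := by simpa [one_add_one_eq_two] using (hf i).1
      exact (contDiff_succ_iff_deriv.1 h2).2.2
    exact this.differentiable one_ne_zero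
  set R := roughRemainder f x y m s u with hR
  set α : ℝ := ∑ i, f i (y s) * (x u i - x s i) with hα
  set G : ℝ := ∑ i, ∑ j, f i (y s) * deriv (f j) (y s) * smoothLift x s u i j with hG
  set β : ℝ := (m u - m s) + G + R with hβ
  have hαle : |α| ≤ B * ρ := by
    rw [hB, mul_assoc]
    refine abs_sum_fin_le fun i => ?_
    rw [abs_mul]
    exact mul_le_mul (hA i _).1 (hsu i) (abs_nonneg _) hA0
  have hGle : |G| ≤ B ^ 2 * ρ ^ 2 := by
    refine (abs_sum_sum_fin_le (c := A * A * ρ ^ 2) fun i j => ?_).trans_eq (by rw [hB]; ring)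
    rw [abs_mul, abs_mul]
    exact mul_le_mul (mul_le_mul (hA i _).1 (hA j _).2.1 (abs_nonneg _) hA0) (hXsu i j)
      (abs_nonneg _) (by positivity)
  have hy : y u = y s + α + β := by
    rw [hβ, hR, roughRemainder]
    ring
  have hβle : |β| ≤ (m u - m s + |R|) + B ^ 2 * ρ ^ 2 := by
    have h1 := abs_add_le (m u - m s + G) R
    have h2 := abs_add_le (m u - m s) G
    rw [abs_of_nonneg (sub_nonneg.2 hm)] at h2
    linarith
  set D := m u - m s + |R| with hD
  have hD0 : 0 ≤ D := add_nonneg (sub_nonneg.2 hm) (abs_nonneg _)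
  have hfirst (j) : |f j (y u) - f j (y s) - deriv (f j) (y s) * α|
      ≤ A * (B * ρ) ^ 2 + A * (D + B ^ 2 * ρ ^ 2) := by
    have h1 := abs_taylor_one_le (hd j) (hd' j) (fun z => (hA j z).2.2) (y s) α
    have h2 := abs_sub_le_of_abs_deriv_le (hd j) (fun z => (hA j z).2.1) (y s + α) (y s + α + β)
    rw [add_sub_cancel_left] at h2
    have h3 : α ^ 2 ≤ (B * ρ) ^ 2 := sq_le_sq.2 (hαle.trans (le_abs_self _))
    have h4 : A * α ^ 2 ≤ A * (B * ρ) ^ 2 := mul_le_mul_of_nonneg_left h3 hA0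
    have h5 : A * |β| ≤ A * (D + B ^ 2 * ρ ^ 2) := mul_le_mul_of_nonneg_left hβle hA0
    have h6 := abs_add_le (f j (y s + α) - f j (y s) - deriv (f j) (y s) * α)
      (f j (y s + α + β) - f j (y s + α))
    calc _ = |f j (y s + α) - f j (y s) - deriv (f j) (y s) * α
        + (f j (y s + α + β) - f j (y s + α))| := by rw [hy]; ring_nf
      _ ≤ _ := by linarith
  have hδy : |y u - y s| ≤ B * ρ + (D + B ^ 2 * ρ ^ 2) := by
    have : y u - y s = α + β := by rw [hy]; ring
    rw [this]
    exact (abs_add_le _ _).trans (add_le_add hαle hβle)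
  have hsecond (i j) : |f i (y u) * deriv (f j) (y u) - f i (y s) * deriv (f j) (y s)|
      ≤ 2 * A ^ 2 * (B * ρ + (D + B ^ 2 * ρ ^ 2)) := by
    have h1 := (abs_sub_le_of_abs_deriv_le (hd i) (fun z => (hA i z).2.1) (y s) (y u)).trans
      (mul_le_mul_of_nonneg_left hδy hA0)
    have h2 := (abs_sub_le_of_abs_deriv_le (hd' j) (fun z => (hA j z).2.2) (y s) (y u)).trans
      (mul_le_mul_of_nonneg_left hδy hA0)
    calc _ = |f i (y u) * (deriv (f j) (y u) - deriv (f j) (y s))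
          + (f i (y u) - f i (y s)) * deriv (f j) (y s)| := by ring_nf
      _ ≤ |f i (y u)| * |deriv (f j) (y u) - deriv (f j) (y s)|
          + |f i (y u) - f i (y s)| * |deriv (f j) (y s)| := by
        rw [← abs_mul, ← abs_mul]; exact abs_add_le _ _
      _ ≤ A * (A * (B * ρ + (D + B ^ 2 * ρ ^ 2))) + A * (B * ρ + (D + B ^ 2 * ρ ^ 2)) * A := by
        gcongr
        · exact (hA i _).1
        · exact (hA j _).2.1
      _ = _ := by ring
  rw [roughRemainder_defect_eq f hx y m s u t]
  have hS1 : |∑ j, (f j (y u) - f j (y s) - deriv (f j) (y s) * α) * (x t j - x u j)|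
      ≤ N * ((A * (B * ρ) ^ 2 + A * (D + B ^ 2 * ρ ^ 2)) * ρ) := by
    refine abs_sum_fin_le fun j => ?_
    rw [abs_mul]
    exact mul_le_mul (hfirst j) (hut j) (abs_nonneg _) (by positivity)
  have hS2 : |∑ i, ∑ j, (f i (y u) * deriv (f j) (y u) - f i (y s) * deriv (f j) (y s))
      * smoothLift x u t i j| ≤ N * (N * (2 * A ^ 2 * (B * ρ + (D + B ^ 2 * ρ ^ 2)) * ρ ^ 2)) := by
    refine abs_sum_sum_fin_le fun i j => ?_
    rw [abs_mul]
    exact mul_le_mul (hsecond i j) (hXut i j) (abs_nonneg _) (by positivity)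
  refine (abs_add_le _ _).trans ((add_le_add hS1 hS2).trans ?_)
  have e1 : N * ((A * (B * ρ) ^ 2 + A * (D + B ^ 2 * ρ ^ 2)) * ρ)
      = 2 * B ^ 3 * ρ ^ 3 + B * (ρ * D) := by rw [hB]; ring
  have e2 : N * (N * (2 * A ^ 2 * (B * ρ + (D + B ^ 2 * ρ ^ 2)) * ρ ^ 2))
      = 2 * B ^ 3 * ρ ^ 3 + 2 * B ^ 2 * (ρ ^ 2 * D) + 2 * B ^ 4 * ρ ^ 4 := by rw [hB]; ring
  have e3 : ρ ^ 2 * D ≤ ρ * D := by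
    refine mul_le_mul_of_nonneg_right ?_ hD0
    nlinarith
  have e4 : ρ ^ 4 ≤ ρ ^ 3 := pow_le_pow_of_le_one hρ0 hρ1 (by norm_num)
  rw [e1, e2]
  have e5 : 2 * B ^ 2 * (ρ ^ 2 * D) ≤ 2 * B ^ 2 * (ρ * D) := by gcongr
  have e6 : 2 * B ^ 4 * ρ ^ 4 ≤ 2 * B ^ 4 * ρ ^ 3 := by gcongr
  have e7 : 0 ≤ (2 * B ^ 2 + B) * ρ ^ 3 := by positivity
  have e8 : 0 ≤ (4 * B ^ 3 + 2 * B ^ 4) * (ρ * D) := by positivity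
  linarith

lemma IsControl.self_eq_zero {a b : ℝ} {ω : ℝ → ℝ → ℝ} (h : IsControl a b ω) {s : ℝ}
    (has : a ≤ s) (hsb : s ≤ b) : ω s s = 0 := by
  have h1 := h.1 s s has le_rfl hsb
  have h2 := h.2 s s s has le_rfl le_rfl hsb
  linarith

lemma IsControl.le_of_subinterval {a b : ℝ} {ω : ℝ → ℝ → ℝ} (h : IsControl a b ω) {s u v t : ℝ}
    (has : a ≤ s) (hsu : s ≤ u) (huv : u ≤ v) (hvt : v ≤ t) (htb : t ≤ b) : ω u v ≤ ω s t := by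
  have h1 := h.2 s u t has hsu (huv.trans hvt) htb
  have h2 := h.2 u v t (has.trans hsu) huv hvt htb
  have h3 := h.1 s u has hsu (by linarith)
  have h4 := h.1 v t (by linarith) hvt htb
  linarith

lemma IsControl.restrict {a b c d : ℝ} {ω : ℝ → ℝ → ℝ} (h : IsControl a b ω) (hac : a ≤ c)
    (hdb : d ≤ b) : IsControl c d ω :=
  ⟨fun s t hs hst ht => h.1 s t (hac.trans hs) hst (ht.trans hdb),
    fun s u t hs hsu hut ht => h.2 s u t (hac.trans hs) hsu hut (ht.trans hdb)⟩

lemma IsRegularControl.restrict {a b c d : ℝ} {ω : ℝ → ℝ → ℝ} (h : IsRegularControl a b ω)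
    (hac : a ≤ c) (hdb : d ≤ b) : IsRegularControl c d ω := by
  refine ⟨h.1.restrict hac hdb, fun ε hε => ?_⟩
  obtain ⟨δ, hδ, H⟩ := h.2 ε hε
  exact ⟨δ, hδ, fun s t hs hst ht => H s t (hac.trans hs) hst (ht.trans hdb)⟩

lemma IsControl.add_increment {a b : ℝ} {ω : ℝ → ℝ → ℝ} {m : ℝ → ℝ} (h : IsControl a b ω)
    (hm : MonotoneOn m (Icc a b)) : IsControl a b fun s t => ω s t + (m t - m s) := by
  refine ⟨fun s t hs hst ht => ?_, fun s u t hs hsu hut ht => ?_⟩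
  · exact add_nonneg (h.1 s t hs hst ht)
      (sub_nonneg.2 (hm ⟨hs, hst.trans ht⟩ ⟨hs.trans hst, ht⟩ hst))
  · have := h.2 s u t hs hsu hut ht
    simp only
    linarith

lemma IsRegularControl.add_length {a b : ℝ} {ω : ℝ → ℝ → ℝ} (h : IsRegularControl a b ω) :
    IsRegularControl a b fun s t => ω s t + (t - s) := by
  refine ⟨h.1.add_increment (m := fun t => t) (monotone_id.monotoneOn _), fun ε hε => ?_⟩
  obtain ⟨δ, hδ, H⟩ := h.2 (ε / 2) (half_pos hε)
  refine ⟨min δ (ε / 2), lt_min hδ (half_pos hε), fun s t hs hst ht hlt => ?_⟩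
  have h1 := H s t hs hst ht (hlt.trans_le (min_le_left _ _))
  have h2 := hlt.trans_le (min_le_right _ _)
  simp only
  linarith

/-- A regular control need not be continuous, but an interval always splits into three pieces on
each of which the control is at most halved. -/
lemma IsRegularControl.exists_split {a b : ℝ} {W : ℝ → ℝ → ℝ} (h : IsRegularControl a b W)
    {s t : ℝ} (has : a ≤ s) (hst : s ≤ t) (htb : t ≤ b) (hpos : 0 < W s t) :
    ∃ u v, s ≤ u ∧ u ≤ v ∧ v ≤ t ∧
      W s u ≤ W s t / 2 ∧ W u v ≤ W s t / 2 ∧ W v t ≤ W s t / 2 := by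
  obtain ⟨δ, hδ, H⟩ := h.2 (W s t / 2) (half_pos hpos)
  set S : Set ℝ := {u | s ≤ u ∧ u ≤ t ∧ W s u ≤ W s t / 2} with hS
  have hsS : s ∈ S := ⟨le_rfl, hst, by rw [h.1.self_eq_zero has (hst.trans htb)]; positivity⟩
  have hbdd : BddAbove S := ⟨t, fun u hu => hu.2.1⟩
  obtain ⟨u, hu, hcu⟩ := exists_lt_of_lt_csSup ⟨s, hsS⟩
    (show sSup S - δ / 2 < sSup S by linarith)
  have huc : u ≤ sSup S := le_csSup hbdd hu
  have huv : u ≤ min t (sSup S + δ / 4) := le_min hu.2.1 (by linarith)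
  refine ⟨u, min t (sSup S + δ / 4), hu.1, huv, min_le_left _ _, hu.2.2, ?_, ?_⟩
  · refine (H _ _ (has.trans hu.1) huv ((min_le_left _ _).trans htb) ?_).le
    have := min_le_right t (sSup S + δ / 4)
    linarith
  · rcases le_total t (sSup S + δ / 4) with ht | ht
    · rw [min_eq_left ht, h.1.self_eq_zero (has.trans hst) htb]
      positivity
    · rw [min_eq_right ht]
      have hsv : s ≤ sSup S + δ / 4 := by linarith [hu.1]
      have hnot : sSup S + δ / 4 ∉ S := fun hmem => by linarith [le_csSup hbdd hmem]
      have hgt : W s t / 2 < W s (sSup S + δ / 4) := by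
        by_contra hle
        exact hnot ⟨hsv, ht, not_lt.1 hle⟩
      have := h.1.2 s _ t has hsv ht htb
      linarith

/-- A sewing-type estimate: an almost additive two-parameter function with an a priori bound of
the right shape satisfies the same bound with a universal constant. -/
lemma abs_le_of_almost_additive {a b : ℝ} {W V R : ℝ → ℝ → ℝ} {γ c ε K₀ : ℝ}
    (hW : IsRegularControl a b W) (hWpos : ∀ s t, a ≤ s → s < t → t ≤ b → 0 < W s t)
    (hV : IsControl a b V) (hγ : 0 < γ) (hc : 0 ≤ c) (hε0 : 0 ≤ ε)
    (hε : ε ≤ (1 - (1 / 2 : ℝ) ^ γ) / 4)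
    (hRself : ∀ s, R s s = 0)
    (hdefect : ∀ s u t, a ≤ s → s ≤ u → u ≤ t → t ≤ b →
      |R s t - R s u - R u t| ≤ c * (W s t ^ γ * V s t) + ε * |R s u|)
    (hK₀ : 0 ≤ K₀)
    (hapriori : ∀ s t, a ≤ s → s ≤ t → t ≤ b → |R s t| ≤ K₀ * (W s t ^ γ * V s t))
    {s t : ℝ} (has : a ≤ s) (hst : s ≤ t) (htb : t ≤ b) :
    |R s t| ≤ 4 * c / (1 - (1 / 2 : ℝ) ^ γ) * (W s t ^ γ * V s t) := by
  set l : ℝ := (1 / 2 : ℝ) ^ γ with hl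
  have hl0 : 0 < l := by positivity
  have hl1 : l < 1 := Real.rpow_lt_one (by norm_num) (by norm_num) hγ
  have hQ0 : ∀ s t, a ≤ s → s ≤ t → t ≤ b → 0 ≤ W s t ^ γ * V s t := fun s t h1 h2 h3 =>
    mul_nonneg (Real.rpow_nonneg (hW.1.1 s t h1 h2 h3) _) (hV.1 s t h1 h2 h3)
  have hQmono : ∀ s u v t, a ≤ s → s ≤ u → u ≤ v → v ≤ t → t ≤ b →
      W u v ^ γ * V u v ≤ W s t ^ γ * V s t := fun s u v t h1 h2 h3 h4 h5 =>
    mul_le_mul (Real.rpow_le_rpow (hW.1.1 u v (by linarith) h3 (by linarith))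
      (hW.1.le_of_subinterval h1 h2 h3 h4 h5) hγ.le) (hV.le_of_subinterval h1 h2 h3 h4 h5)
      (hV.1 u v (by linarith) h3 (by linarith))
      (Real.rpow_nonneg (hW.1.1 s t h1 (by linarith) h5) _)
  have step : ∀ K, 0 ≤ K → (∀ s t, a ≤ s → s ≤ t → t ≤ b → |R s t| ≤ K * (W s t ^ γ * V s t)) →
      ∀ s t, a ≤ s → s ≤ t → t ≤ b →
        |R s t| ≤ ((1 + l) / 2 * K + 2 * c) * (W s t ^ γ * V s t) := by
    intro K hK hR s t h1 h2 h3
    rcases h2.eq_or_lt with rfl | hlt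
    · rw [hRself, abs_zero]
      exact mul_nonneg (by positivity) (hQ0 s s h1 h2 h3)
    obtain ⟨u, v, hsu, huv, hvt, h4, h5, h6⟩ := hW.exists_split h1 h2 h3 (hWpos s t h1 hlt h3)
    have hhalf : ∀ q r, s ≤ q → q ≤ r → r ≤ t → W q r ≤ W s t / 2 →
        |R q r| ≤ K * (l * W s t ^ γ * V q r) := by
      intro q r h7 h8 h9 h10
      refine (hR q r (by linarith) h8 (by linarith)).trans ?_
      have hVqr := hV.1 q r (by linarith) h8 (by linarith)
      have hWqr := hW.1.1 q r (by linarith) h8 (by linarith)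
      have : W q r ^ γ ≤ l * W s t ^ γ := by
        rw [hl, ← Real.mul_rpow (by norm_num) (hW.1.1 s t h1 h2 h3)]
        exact Real.rpow_le_rpow hWqr (by linarith) hγ.le
      gcongr
    have hsum : |R s u| + |R u v| + |R v t| ≤ K * (l * (W s t ^ γ * V s t)) := by
      have hVsum : V s u + V u v + V v t ≤ V s t := by
        have := hV.2 s u t h1 hsu (by linarith) h3
        have := hV.2 u v t (by linarith) huv hvt h3
        linarith
      have hWst : 0 ≤ W s t ^ γ := Real.rpow_nonneg (hW.1.1 s t h1 h2 h3) _
      calc _ ≤ K * (l * W s t ^ γ * V s u) + K * (l * W s t ^ γ * V u v)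
            + K * (l * W s t ^ γ * V v t) := by
            gcongr
            · exact hhalf s u le_rfl hsu (by linarith) h4
            · exact hhalf u v hsu huv hvt h5
            · exact hhalf v t (by linarith) hvt le_rfl h6
        _ = K * (l * W s t ^ γ * (V s u + V u v + V v t)) := by ring
        _ ≤ K * (l * W s t ^ γ * V s t) := by gcongr
        _ = _ := by ring
    have hd1 := hdefect s u t h1 hsu (by linarith) h3
    have hd2 := hdefect u v t (by linarith) huv hvt h3
    have hRsu : ε * |R s u| ≤ ε * (K * (W s t ^ γ * V s t)) := by
      refine mul_le_mul_of_nonneg_left ((hR s u h1 hsu (by linarith)).trans ?_) hε0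
      exact mul_le_mul_of_nonneg_left (hQmono s s u t h1 le_rfl hsu (by linarith) h3) hK
    have hRuv : ε * |R u v| ≤ ε * (K * (W s t ^ γ * V s t)) := by
      refine mul_le_mul_of_nonneg_left ((hR u v (by linarith) huv (by linarith)).trans ?_) hε0
      exact mul_le_mul_of_nonneg_left (hQmono s u v t h1 hsu huv hvt h3) hK
    have hcut : c * (W u t ^ γ * V u t) ≤ c * (W s t ^ γ * V s t) :=
      mul_le_mul_of_nonneg_left (hQmono s u t t h1 hsu (by linarith) le_rfl h3) hc
    have htri : |R s t| ≤ |R s u| + |R u v| + |R v t| + |R s t - R s u - R u t|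
        + |R u t - R u v - R v t| := by
      have e : R s t = R s u + R u v + R v t + (R s t - R s u - R u t)
        + (R u t - R u v - R v t) := by ring
      calc |R s t| = _ := congrArg abs e
        _ ≤ _ := (abs_add_le _ _).trans (by
          gcongr
          exact (abs_add_le _ _).trans (by gcongr; exact abs_add_three _ _ _))
    have hfin : ε * (K * (W s t ^ γ * V s t)) ≤ (1 - l) / 4 * (K * (W s t ^ γ * V s t)) :=
      mul_le_mul_of_nonneg_right hε (mul_nonneg hK (hQ0 s t h1 h2 h3))
    linarith
  set θ : ℝ := (1 + l) / 2 with hθ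
  have hθ0 : 0 ≤ θ := by positivity
  have hθ1 : θ < 1 := by rw [hθ]; linarith
  have hne : 1 - l ≠ 0 := by linarith
  have hKs : 0 ≤ 4 * c / (1 - l) := div_nonneg (by positivity) (by linarith)
  have iter : ∀ n : ℕ, ∀ s t, a ≤ s → s ≤ t → t ≤ b →
      |R s t| ≤ (4 * c / (1 - l) + θ ^ n * K₀) * (W s t ^ γ * V s t) := by
    intro n
    induction n with
    | zero =>
      intro s t h1 h2 h3
      refine (hapriori s t h1 h2 h3).trans (mul_le_mul_of_nonneg_right ?_ (hQ0 s t h1 h2 h3))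
      rw [pow_zero, one_mul]
      linarith
    | succ n ih =>
      intro s t h1 h2 h3
      refine (step _ (by positivity) ih s t h1 h2 h3).trans_eq ?_
      congr 1
      rw [pow_succ, hθ]
      field_simp
      ring
  have hlim : Tendsto (fun n : ℕ => (4 * c / (1 - l) + θ ^ n * K₀) * (W s t ^ γ * V s t)) atTop
      (nhds ((4 * c / (1 - l) + 0 * K₀) * (W s t ^ γ * V s t))) :=
    ((((tendsto_pow_atTop_nhds_zero_of_lt_one hθ0 hθ1).mul_const K₀).const_add _).mul_const _)
  rw [zero_mul, add_zero] at hlim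
  exact ge_of_tendsto' hlim fun n => iter n s t has hst htb

lemma abs_increment_le_of_norm_le {N : ℕ} {x : ℝ → Fin N → ℝ} {s t r : ℝ}
    (h : ‖(fun i => x t i - x s i)‖ + ‖(fun i j => smoothLift x s t i j)‖ ^ ((1:ℝ)/2) ≤ r)
    (i : Fin N) : |x t i - x s i| ≤ r := by
  have h1 := norm_le_pi_norm (fun i => x t i - x s i) i
  have h2 : 0 ≤ ‖(fun i j => smoothLift x s t i j)‖ ^ ((1:ℝ)/2) := by positivity
  rw [Real.norm_eq_abs] at h1
  linarith

lemma abs_smoothLift_le_of_norm_le {N : ℕ} {x : ℝ → Fin N → ℝ} {s t r : ℝ}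
    (h : ‖(fun i => x t i - x s i)‖ + ‖(fun i j => smoothLift x s t i j)‖ ^ ((1:ℝ)/2) ≤ r)
    (i j : Fin N) : |smoothLift x s t i j| ≤ r ^ 2 := by
  have h1 : |smoothLift x s t i j| ≤ ‖(fun i j => smoothLift x s t i j)‖ :=
    (norm_le_pi_norm (smoothLift x s t i) j).trans
      (norm_le_pi_norm (fun i j => smoothLift x s t i j) i)
  have h2 : ‖(fun i j => smoothLift x s t i j)‖ ^ ((1:ℝ)/2) ≤ r := by
    linarith [norm_nonneg (fun i => x t i - x s i)]
  rw [← Real.sqrt_eq_rpow] at h2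
  exact h1.trans ((Real.sqrt_le_left ((Real.sqrt_nonneg _).trans h2)).1 h2)

/-- Along a `C¹` driver the remainder is quadratically small, with a constant that depends on the
driver. -/
lemma roughRemainder_le_of_contDiff {N : ℕ} {f : Fin N → ℝ → ℝ} {A T a : ℝ}
    (hf : ∀ i, CbOfDeg 2 (f i))
    (hA : ∀ i z, |f i z| ≤ A ∧ |deriv (f i) z| ≤ A ∧ |deriv (deriv (f i)) z| ≤ A) (hA0 : 0 ≤ A)
    {x : ℝ → Fin N → ℝ} (hx : ContDiff ℝ 1 x) {y m : ℝ → ℝ} {μ : Measure ℝ}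
    (h : SolvesReflectedODE T f x a y m μ) :
    ∃ K, 0 ≤ K ∧ ∀ s t, 0 ≤ s → s ≤ t → t ≤ T →
      |roughRemainder f x y m s t| ≤ K * ((t - s) * ((t - s) + (m t - m s))) := by
  obtain ⟨hyc, -, -, hmono, -, -, -, heq, -, -⟩ := h
  have hN : (0 : ℝ) ≤ N := Nat.cast_nonneg N
  obtain ⟨L, hL0, hL⟩ : ∃ L, 0 ≤ L ∧ ∀ i, ∀ u ∈ Icc 0 T, |deriv (fun v => x v i) u| ≤ L := by
    choose c hc using fun i => isCompact_Icc.exists_bound_of_continuousOn (s := Icc 0 T)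
      (continuous_deriv_coord hx i).continuousOn
    refine ⟨∑ i, |c i|, Finset.sum_nonneg fun _ _ => abs_nonneg _, fun i u hu => ?_⟩
    exact (hc i u hu).trans ((le_abs_self _).trans
      (Finset.single_le_sum (f := fun k => |c k|) (fun _ _ => abs_nonneg _) (Finset.mem_univ i)))
  have hxL : ∀ i s t, 0 ≤ s → s ≤ t → t ≤ T → |x t i - x s i| ≤ L * (t - s) := by
    intro i s t h1 h2 h3
    rw [← integral_deriv_coord hx i]
    have := intervalIntegral.norm_integral_le_of_norm_le_const (a := s) (b := t) (C := L)
      (f := deriv fun v => x v i) fun u hu => by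
        rw [uIoc_of_le h2] at hu
        exact hL i u ⟨h1.trans hu.1.le, hu.2.trans h3⟩
    rwa [abs_of_nonneg (sub_nonneg.2 h2)] at this
  have hXL : ∀ i j s t, 0 ≤ s → s ≤ t → t ≤ T →
      |smoothLift x s t i j| ≤ L * (t - s) * L * (t - s) := by
    intro i j s t h1 h2 h3
    have := intervalIntegral.norm_integral_le_of_norm_le_const (a := s) (b := t)
      (C := L * (t - s) * L) (f := fun u => (x u i - x s i) * deriv (fun v => x v j) u)
      fun u hu => by
        rw [uIoc_of_le h2] at hu
        rw [norm_mul]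
        have hts : 0 ≤ t - s := sub_nonneg.2 h2
        refine mul_le_mul ?_ (hL j u ⟨h1.trans hu.1.le, hu.2.trans h3⟩) (norm_nonneg _)
          (by positivity)
        refine (hxL i s u h1 hu.1.le (hu.2.trans h3)).trans ?_
        gcongr
        exact hu.2
    rwa [abs_of_nonneg (sub_nonneg.2 h2)] at this
  have hd (i) : Differentiable ℝ (f i) := (hf i).1.differentiable two_ne_zero
  refine ⟨N * A * L * (N * A * L + 1) + (N * A * L) ^ 2, by positivity,
    fun s t h1 h2 h3 => ?_⟩
  have hts : 0 ≤ t - s := sub_nonneg.2 h2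
  have hmst : 0 ≤ m t - m s := sub_nonneg.2 (hmono ⟨h1, by linarith⟩ ⟨by linarith, h3⟩ h2)
  have hycst : ContinuousOn y (uIcc s t) := by
    rw [uIcc_of_le h2]
    exact hyc.mono (Icc_subset_Icc h1 h3)
  have hintegrable (j) :
      IntervalIntegrable (fun u => f j (y u) * deriv (fun v => x v j) u) volume s t :=
    (((hd j).continuous.comp_continuousOn hycst).mul
      (continuous_deriv_coord hx j).continuousOn).intervalIntegrable
  have hδy : ∀ u ∈ Icc s t, |y u - y s| ≤ N * A * L * (t - s) + (m t - m s) := by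
    intro u hu
    rw [heq s u h1 hu.1 (hu.2.trans h3)]
    have hu' : u ∈ Icc 0 T := ⟨h1.trans hu.1, hu.2.trans h3⟩
    have hm1 := hmono ⟨h1, by linarith⟩ hu' hu.1
    have hm2 := hmono hu' ⟨by linarith, h3⟩ hu.2
    refine (abs_add_le _ _).trans (add_le_add ?_ ?_)
    · refine (abs_sum_fin_le (c := A * L * (t - s)) fun j => ?_).trans_eq (by ring)
      have := intervalIntegral.norm_integral_le_of_norm_le_const (a := s) (b := u)
        (C := A * L) (f := fun u => f j (y u) * deriv (fun v => x v j) u) fun w hw => by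
          rw [uIoc_of_le hu.1] at hw
          rw [norm_mul]
          exact mul_le_mul (hA j _).1 (hL j w ⟨h1.trans hw.1.le, by linarith [hw.2, hu.2]⟩)
            (norm_nonneg _) hA0
      rw [abs_of_nonneg (sub_nonneg.2 hu.1)] at this
      refine this.trans ?_
      gcongr
      exact hu.2
    · rw [abs_of_nonneg (by linarith)]
      linarith
  have hR : roughRemainder f x y m s t
      = (∑ j, ∫ u in s..t, (f j (y u) - f j (y s)) * deriv (fun v => x v j) u)
        - ∑ i, ∑ j, f i (y s) * deriv (f j) (y s) * smoothLift x s t i j := by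
    unfold roughRemainder
    rw [heq s t h1 h2 h3, add_sub_cancel_right, ← Finset.sum_sub_distrib]
    congr 1
    refine Finset.sum_congr rfl fun j _ => ?_
    rw [← integral_deriv_coord hx j, ← intervalIntegral.integral_const_mul,
      ← intervalIntegral.integral_sub (hintegrable j)
        (intervalIntegrable_const_mul_deriv_coord hx j _ _ _)]
    simp only [sub_mul]
  have hS1 : |∑ j, ∫ u in s..t, (f j (y u) - f j (y s)) * deriv (fun v => x v j) u|
      ≤ N * (A * (N * A * L * (t - s) + (m t - m s)) * L * (t - s)) := by
    refine abs_sum_fin_le fun j => ?_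
    have := intervalIntegral.norm_integral_le_of_norm_le_const (a := s) (b := t)
      (C := A * (N * A * L * (t - s) + (m t - m s)) * L)
      (f := fun u => (f j (y u) - f j (y s)) * deriv (fun v => x v j) u) fun w hw => by
        rw [uIoc_of_le h2] at hw
        rw [norm_mul]
        refine mul_le_mul ?_ (hL j w ⟨h1.trans hw.1.le, hw.2.trans h3⟩) (norm_nonneg _)
          (by positivity)
        exact (abs_sub_le_of_abs_deriv_le (hd j) (fun z => (hA j z).2.1) _ _).trans
          (mul_le_mul_of_nonneg_left (hδy w ⟨hw.1.le, hw.2⟩) hA0)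
    rwa [abs_of_nonneg hts] at this
  have hS2 : |∑ i, ∑ j, f i (y s) * deriv (f j) (y s) * smoothLift x s t i j|
      ≤ N * (N * (A * A * (L * (t - s) * L * (t - s)))) := by
    refine abs_sum_sum_fin_le fun i j => ?_
    rw [abs_mul, abs_mul]
    exact mul_le_mul (mul_le_mul (hA i _).1 (hA j _).2.1 (abs_nonneg _) hA0)
      (hXL i j s t h1 h2 h3) (abs_nonneg _) (by positivity)
  rw [hR]
  refine (abs_sub _ _).trans ((add_le_add hS1 hS2).trans ?_)
  have e1 : 0 ≤ N * A * L * ((t - s) * (t - s)) := by positivity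
  have e2 : 0 ≤ N * A * L * (N * A * L) * ((t - s) * (m t - m s)) := by positivity
  nlinarith [e1, e2]

/-- On an interval where the driver is small, the total increase of the reflection is bounded by a
constant depending only on the coefficients. -/
lemma reflection_increment_le {N : ℕ} {p : ℝ} (hp2 : 2 ≤ p) (hp3 : p < 3)
    {f : Fin N → ℝ → ℝ} {A T a C₀ : ℝ} (hf : ∀ i, CbOfDeg 2 (f i))
    (hA : ∀ i z, |f i z| ≤ A ∧ |deriv (f i) z| ≤ A ∧ |deriv (deriv (f i)) z| ≤ A) (hA0 : 0 ≤ A)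
    (hC₀ : C₀ = 4 * (N * A) ^ 3 + 2 * (N * A) ^ 4 + 2 * (N * A) ^ 2 + N * A)
    {ω : ℝ → ℝ → ℝ} (hω : IsRegularControl 0 T ω)
    {x : ℝ → Fin N → ℝ} (hx : ContDiff ℝ 1 x)
    (hxω : ∀ s t, 0 ≤ s → s ≤ t → t ≤ T →
      ‖(fun i => x t i - x s i)‖ + ‖(fun i j => smoothLift x s t i j)‖ ^ ((1:ℝ)/2)
        ≤ ω s t ^ (1 / p))
    {y m : ℝ → ℝ} {μ : Measure ℝ} (h : SolvesReflectedODE T f x a y m μ)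
    {b c : ℝ} (hb : 0 ≤ b) (hbc : b ≤ c) (hcT : c ≤ T)
    (hsmall1 : ω b c + (c - b) ≤ 1)
    (hsmall2 : C₀ * (ω b c + (c - b)) ^ (1 / p) ≤ (1 - (1 / 2 : ℝ) ^ (3 / p - 1)) / 4)
    (hsmall3 : 4 * C₀ / (1 - (1 / 2 : ℝ) ^ (3 / p - 1)) * (ω b c + (c - b)) ^ (3 / p - 1)
      ≤ 1 / 2) :
    m c - m b ≤ 2 * (N * A) + 2 * (N * A) ^ 2 + 1 := by
  obtain ⟨K, hK0, hK⟩ := roughRemainder_le_of_contDiff hf hA hA0 hx h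
  obtain ⟨hyc, hy0, -, hmono, -, -, -, -, hμ, hμ0⟩ := h
  have hN : (0 : ℝ) ≤ N := Nat.cast_nonneg N
  have hp0 : 0 < p := by linarith
  set γ : ℝ := 3 / p - 1 with hγdef
  have hγ : 0 < γ := by rw [hγdef, sub_pos, lt_div_iff₀ hp0]; linarith
  have hγp : γ ≤ 1 / p := by
    rw [hγdef, sub_le_iff_le_add, ← sub_le_iff_le_add', ← sub_div, div_le_one hp0]
    linarith
  have hγ1 : γ ≤ 1 := hγp.trans (by rw [div_le_one hp0]; linarith)
  set W : ℝ → ℝ → ℝ := fun s t => ω s t + (t - s) with hWdef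
  have hW : IsRegularControl b c W := hω.add_length.restrict hb hcT
  set V : ℝ → ℝ → ℝ := fun s t => W s t + (m t - m s) with hVdef
  have hV : IsControl b c V := hW.1.add_increment (hmono.mono (Icc_subset_Icc hb hcT))
  have hω0 : ∀ s t, b ≤ s → s ≤ t → t ≤ c → 0 ≤ ω s t := fun s t h1 h2 h3 =>
    hω.1.1 s t (hb.trans h1) h2 (h3.trans hcT)
  have hm : ∀ s t, b ≤ s → s ≤ t → t ≤ c → m s ≤ m t := fun s t h1 h2 h3 =>
    hmono ⟨by linarith, by linarith⟩ ⟨by linarith, by linarith⟩ h2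
  have hC₀nn : 0 ≤ C₀ := by rw [hC₀]; positivity
  have hW1 : ∀ s t, b ≤ s → s ≤ t → t ≤ c → W s t ≤ 1 := fun s t h1 h2 h3 =>
    (hW.1.le_of_subinterval le_rfl h1 h2 h3 le_rfl).trans hsmall1
  have hωW : ∀ s u v t, b ≤ s → s ≤ u → u ≤ v → v ≤ t → t ≤ c →
      ω u v ^ (1 / p) ≤ W s t ^ (1 / p) := by
    intro s u v t h1 h2 h3 h4 h5
    refine Real.rpow_le_rpow (hω0 u v (by linarith) h3 (by linarith)) ?_ (by positivity)
    have := hW.1.le_of_subinterval h1 h2 h3 h4 h5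
    simp only [hWdef] at this ⊢
    linarith
  have hxle : ∀ s u v t, b ≤ s → s ≤ u → u ≤ v → v ≤ t → t ≤ c → ∀ i,
      |x v i - x u i| ≤ W s t ^ (1 / p) := fun s u v t h1 h2 h3 h4 h5 =>
    abs_increment_le_of_norm_le
      ((hxω u v (by linarith) h3 (by linarith)).trans (hωW s u v t h1 h2 h3 h4 h5))
  have hXle : ∀ s u v t, b ≤ s → s ≤ u → u ≤ v → v ≤ t → t ≤ c → ∀ i j,
      |smoothLift x u v i j| ≤ (W s t ^ (1 / p)) ^ 2 := fun s u v t h1 h2 h3 h4 h5 =>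
    abs_smoothLift_le_of_norm_le
      ((hxω u v (by linarith) h3 (by linarith)).trans (hωW s u v t h1 h2 h3 h4 h5))
  have hR : ∀ s t, b ≤ s → s ≤ t → t ≤ c → |roughRemainder f x y m s t|
      ≤ 4 * C₀ / (1 - (1 / 2 : ℝ) ^ γ) * (W s t ^ γ * V s t) := by
    intro s t h1 h2 h3
    refine abs_le_of_almost_additive (ε := C₀ * W b c ^ (1 / p)) (K₀ := K) hW ?_ hV hγ hC₀nn ?_
      hsmall2 ?_ ?_ hK0 ?_ h1 h2 h3
    · intro s t h1 h2 h3
      have := hω0 s t h1 h2.le h3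
      simp only [hWdef]
      linarith
    · exact mul_nonneg hC₀nn (Real.rpow_nonneg (hW.1.1 b c le_rfl hbc le_rfl) _)
    · intro s
      simp [roughRemainder, smoothLift]
    · intro s u t h1 h2 h3 h4
      have hWst := hW.1.1 s t h1 (h2.trans h3) h4
      set ρ := W s t ^ (1 / p) with hρ
      have hρ0 : 0 ≤ ρ := Real.rpow_nonneg hWst _
      have hρ1 : ρ ≤ 1 := Real.rpow_le_one hWst (hW1 s t h1 (h2.trans h3) h4) (by positivity)
      refine (roughRemainder_defect_le hf hA hA0 hx y m hρ0 hρ1 (hm s u h1 h2 (h3.trans h4))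
        (hxle s s u t h1 le_rfl h2 h3 h4) (hxle s u t t h1 h2 h3 le_rfl h4)
        (hXle s s u t h1 le_rfl h2 h3 h4) (hXle s u t t h1 h2 h3 le_rfl h4)).trans ?_
      rw [← hC₀]
      have hρ3 : ρ ^ 3 = W s t ^ γ * W s t := by
        rw [hρ, ← Real.rpow_natCast, ← Real.rpow_mul hWst, hγdef,
          ← Real.rpow_add_one' hWst (by rw [sub_add_cancel]; positivity)]
        congr 1
        push_cast
        ring
      have hργ : ρ ≤ W s t ^ γ := by
        rcases hWst.eq_or_lt with h0 | hpos
        · rw [hρ, ← h0, Real.zero_rpow (by positivity)]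
          exact Real.rpow_nonneg le_rfl _
        · exact Real.rpow_le_rpow_of_exponent_ge hpos (hW1 s t h1 (h2.trans h3) h4) hγp
      have hρb : ρ ≤ W b c ^ (1 / p) := Real.rpow_le_rpow hWst
        (hW.1.le_of_subinterval le_rfl h1 (h2.trans h3) h4 le_rfl) (by positivity)
      have hmu : ρ * (m u - m s) ≤ W s t ^ γ * (m t - m s) := by
        have := hm u t (h1.trans h2) h3 h4
        exact mul_le_mul hργ (by linarith) (sub_nonneg.2 (hm s u h1 h2 (h3.trans h4)))
          (Real.rpow_nonneg hWst _)
      have hRb : ρ * |roughRemainder f x y m s u|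
          ≤ W b c ^ (1 / p) * |roughRemainder f x y m s u| := by gcongr
      have hin : ρ ^ 3 + ρ * (m u - m s + |roughRemainder f x y m s u|)
          ≤ W s t ^ γ * V s t + W b c ^ (1 / p) * |roughRemainder f x y m s u| := by
        rw [hρ3]
        simp only [hVdef]
        linarith
      exact (mul_le_mul_of_nonneg_left hin hC₀nn).trans_eq (by ring)
    · intro s t h1 h2 h3
      refine (hK s t (hb.trans h1) h2 (h3.trans hcT)).trans ?_
      have hωst := hω0 s t h1 h2 h3
      have hWst := hW.1.1 s t h1 h2 h3
      have hmst := hm s t h1 h2 h3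
      have hlen : t - s ≤ W s t := by simp only [hWdef]; linarith
      have hWγ : W s t ≤ W s t ^ γ := by
        rcases hWst.eq_or_lt with h0 | hpos
        · rw [← h0]
          exact Real.rpow_nonneg le_rfl _
        · simpa using Real.rpow_le_rpow_of_exponent_ge hpos (hW1 s t h1 h2 h3) hγ1
      refine mul_le_mul_of_nonneg_left (mul_le_mul (hlen.trans hWγ) ?_ ?_ ?_) hK0
      · simp only [hVdef]
        linarith
      · linarith
      · exact Real.rpow_nonneg hWst _
  -- no reflection on an interval free of zeros
  have hflat : ∀ v, b ≤ v → v ≤ c → (∀ u, v < u → u ≤ c → y u ≠ 0) → m c ≤ m v := by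
    intro v h1 h2 h3
    have hsub : Ioc v c ⊆ {u | u ∈ Ioc 0 T ∧ y u ≠ 0} := fun u hu =>
      ⟨⟨by linarith [hu.1], hu.2.trans hcT⟩, h3 u hu.1 hu.2⟩
    have hnull : μ (Ioc v c) = 0 := measure_mono_null hsub hμ0
    rw [hμ v c (hb.trans h1) h2 hcT, ENNReal.ofReal_eq_zero] at hnull
    linarith
  set Z : Set ℝ := {u | u ∈ Icc b c ∧ y u = 0} with hZ
  rcases Z.eq_empty_or_nonempty with hempty | hne
  · have hmc := hflat b le_rfl hbc fun u h1 h2 h3 => by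
      have : u ∈ Z := ⟨⟨h1.le, h2⟩, h3⟩
      rw [hempty] at this
      exact this
    have : 0 ≤ 2 * (N * A) + 2 * (N * A) ^ 2 + 1 := by positivity
    linarith
  have hZc : IsCompact Z := isCompact_Icc.of_isClosed_subset
    ((hyc.mono (Icc_subset_Icc hb hcT)).preimage_isClosed_of_isClosed isClosed_Icc
      (isClosed_singleton (x := (0 : ℝ)))) fun u hu => hu.1
  obtain ⟨v, ⟨⟨hbv, hvc⟩, hyv⟩, hvmax⟩ := hZc.exists_isGreatest hne
  have hmv := hflat v hbv hvc fun u h1 h2 h3 =>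
    absurd (hvmax (show u ∈ Z from ⟨⟨by linarith, h2⟩, h3⟩)) (not_le.2 h1)
  have hS1 : |∑ j, f j (y b) * (x v j - x b j)| ≤ N * A := by
    refine abs_sum_fin_le fun j => ?_
    rw [abs_mul, ← mul_one A]
    refine mul_le_mul (hA j _).1 ((hxle b b v c le_rfl le_rfl hbv hvc le_rfl j).trans ?_)
      (abs_nonneg _) hA0
    exact Real.rpow_le_one (hW.1.1 b c le_rfl hbc le_rfl) hsmall1 (by positivity)
  have hS2 : |∑ i, ∑ j, f i (y b) * deriv (f j) (y b) * smoothLift x b v i j| ≤ (N * A) ^ 2 := by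
    refine (abs_sum_sum_fin_le (c := A * A * 1) fun i j => ?_).trans_eq (by ring)
    rw [abs_mul, abs_mul]
    refine mul_le_mul (mul_le_mul (hA i _).1 (hA j _).2.1 (abs_nonneg _) hA0)
      ((hXle b b v c le_rfl le_rfl hbv hvc le_rfl i j).trans ?_) (abs_nonneg _) (by positivity)
    have hWbc := hW.1.1 b c le_rfl hbc le_rfl
    exact pow_le_one₀ (Real.rpow_nonneg hWbc _) (Real.rpow_le_one hWbc hsmall1 (by positivity))
  have hRv : |roughRemainder f x y m b v| ≤ 1 / 2 * V b v := by
    refine (hR b v le_rfl hbv hvc).trans ?_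
    have hVbv := hV.1 b v le_rfl hbv hvc
    have hl1 : (1 / 2 : ℝ) ^ γ < 1 := Real.rpow_lt_one (by norm_num) (by norm_num) hγ
    have hKs : 0 ≤ 4 * C₀ / (1 - (1 / 2 : ℝ) ^ γ) := div_nonneg (by positivity) (by linarith)
    rw [← mul_assoc]
    refine mul_le_mul_of_nonneg_right (le_trans ?_ hsmall3) hVbv
    refine mul_le_mul_of_nonneg_left ?_ hKs
    exact Real.rpow_le_rpow (hW.1.1 b v le_rfl hbv hvc)
      (hW.1.le_of_subinterval le_rfl le_rfl hbv hvc le_rfl) hγ.le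
  have hWv := hW1 b v le_rfl hbv hvc
  have hyb := hy0 b ⟨hb, hbc.trans hcT⟩
  have hVv : V b v = W b v + (m v - m b) := rfl
  have hrem : roughRemainder f x y m b v = y v - y b - (m v - m b)
      - (∑ j, f j (y b) * (x v j - x b j))
      - ∑ i, ∑ j, f i (y b) * deriv (f j) (y b) * smoothLift x b v i j := rfl
  rw [hVv] at hRv
  have h1 := neg_abs_le (roughRemainder f x y m b v)
  have h2 := neg_abs_le (∑ j, f j (y b) * (x v j - x b j))
  have h3 := neg_abs_le (∑ i, ∑ j, f i (y b) * deriv (f j) (y b) * smoothLift x b v i j)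
  linarith

/-- **Uniform global bound on the reflection measure of reflected ODEs** (relation
(4.13) / `eq:measure-bounds`): for `f ∈ C²_b`, `2 ≤ p < 3` and a regular control `ω` on
`[0,T]`, there is a constant `C` depending only on `f`, `p` and `ω` such that for every
initial condition `a ≥ 0` and every `C¹` driver `x` controlled, together with its step-2
lift, by `ω`, any solution `(y,m)` of the reflected ODE driven by `x` satisfies
`m_T ≤ C`; in particular the total variation of the reflection measures of the
approximating reflected ODEs is bounded uniformly in the approximation parameter. -/
theorem reflected_ode_measure_global_bound
    (N : ℕ) (p : ℝ) (hp2 : 2 ≤ p) (hp3 : p < 3)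
    (f : Fin N → ℝ → ℝ) (hf : ∀ i, CbOfDeg 2 (f i))
    (T : ℝ) (hT : 0 < T)
    (ω : ℝ → ℝ → ℝ) (hω : IsRegularControl 0 T ω) :
    ∃ C : ℝ, 0 < C ∧
      ∀ (a : ℝ), 0 ≤ a →
      ∀ (x : ℝ → Fin N → ℝ), ContDiff ℝ 1 x →
        (∀ s t, 0 ≤ s → s ≤ t → t ≤ T →
          ‖(fun i => x t i - x s i)‖ + ‖(fun i j => smoothLift x s t i j)‖ ^ ((1:ℝ)/2)
            ≤ ω s t ^ (1 / p)) →
      ∀ (y m : ℝ → ℝ) (μ : MeasureTheory.Measure ℝ), SolvesReflectedODE T f x a y m μ →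
        m T ≤ C := by
  obtain ⟨A, hA0, hA⟩ := exists_common_bound hf
  have hN : (0 : ℝ) ≤ N := Nat.cast_nonneg N
  have hp0 : 0 < p := by linarith
  have hγ : 0 < 3 / p - 1 := by rw [sub_pos, lt_div_iff₀ hp0]; linarith
  have hl1 : (1 / 2 : ℝ) ^ (3 / p - 1) < 1 := Real.rpow_lt_one (by norm_num) (by norm_num) hγ
  obtain ⟨C₀, hC₀⟩ :
      ∃ C₀, C₀ = 4 * (N * A) ^ 3 + 2 * (N * A) ^ 4 + 2 * (N * A) ^ 2 + N * A := ⟨_, rfl⟩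
  -- a threshold below which the local bound applies
  have hlim (k q : ℝ) (hq : 0 < q) : Tendsto (fun e : ℝ => k * e ^ q) (nhds 0) (nhds 0) := by
    have := ((Real.continuousAt_rpow_const 0 q (Or.inr hq.le)).tendsto).const_mul k
    rwa [Real.zero_rpow hq.ne', mul_zero] at this
  have hev := ((hlim C₀ (1 / p) (by positivity)).eventually_le_const
      (show 0 < (1 - (1 / 2 : ℝ) ^ (3 / p - 1)) / 4 by linarith)).and
    (((hlim (4 * C₀ / (1 - (1 / 2 : ℝ) ^ (3 / p - 1))) (3 / p - 1) hγ).eventually_le_const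
      (show (0 : ℝ) < 1 / 2 by norm_num)).and
      ((tendsto_id (x := nhds (0 : ℝ))).eventually_le_const (zero_lt_one' ℝ)))
  obtain ⟨ε, hε, hball⟩ := Metric.eventually_nhds_iff.1 hev
  obtain ⟨δ, hδ, hreg⟩ := hω.add_length.2 ε hε
  obtain ⟨n, hn⟩ := exists_nat_gt (T / δ)
  have hn0 : (0 : ℝ) < n := (by positivity : 0 < T / δ).trans hn
  set B : ℝ := 2 * (N * A) + 2 * (N * A) ^ 2 + 1 with hB
  have hB0 : 0 < B := by positivity
  refine ⟨n * B, by positivity, fun a _ x hx hxω y m μ h => ?_⟩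
  have hstep : ∀ k : ℕ, k ≤ n → m (k * (T / n)) ≤ k * B := by
    intro k
    induction k with
    | zero => intro _; simp [h.2.2.2.2.1]
    | succ k ih =>
      intro hk
      have hk' : ((k + 1 : ℕ) : ℝ) * (T / n) ≤ T := by
        rw [← mul_div_assoc, div_le_iff₀ hn0, mul_comm T]
        gcongr
      have hb : 0 ≤ (k : ℝ) * (T / n) := by positivity
      have hdiff : ((k + 1 : ℕ) : ℝ) * (T / n) - k * (T / n) = T / n := by push_cast; ring
      have hbc : (k : ℝ) * (T / n) ≤ (k + 1 : ℕ) * (T / n) := by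
        have : 0 ≤ T / n := by positivity
        linarith
      have hlt : T / n < δ := by
        rw [div_lt_iff₀ hδ] at hn
        rw [div_lt_iff₀ hn0]
        linarith
      have hWlt := hreg _ _ hb hbc hk' (by rwa [hdiff])
      have hW0 := hω.add_length.1.1 _ _ hb hbc hk'
      obtain ⟨h2, h3, h1⟩ := hball (by rwa [Real.dist_0_eq_abs, abs_of_nonneg hW0])
      have := reflection_increment_le hp2 hp3 hf hA hA0 hC₀ hω hx hxω h hb hbc hk' h1 h2 h3
      have := ih (by omega)
      push_cast at *
      linarith
  have := hstep n le_rfl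
  rwa [mul_div_cancel₀ T hn0.ne'] at this

end
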